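/- Let m ∈ [0,1]. For all ε₁, ε₂ > 0 and all a, b ∈ ℝ, (φ^{ε₁}(a) − φ^{ε₂}(b))·(a − b) ≥ −(ε₁ + ε₂)·(1 + a² + b²). -/

import Mathlib

/-- `ψ(r) = |r|^(m+1)/(m+1)`. -/
noncomputable def psi (m : ℝ) (r : ℝ) : ℝ := |r| ^ (m + 1) / (m + 1)

lemma psi_nonneg {m : ℝ} (hm : 0 ≤ m) (r : ℝ) : 0 ≤ psi m r := by
  unfold psi; positivity

lemma psi_zero {m : ℝ} (hm : 0 ≤ m) : psi m 0 = 0 := by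
  simp [psi, Real.zero_rpow (by linarith : m + 1 ≠ 0)]

lemma convexOn_psi {m : ℝ} (hm : 0 ≤ m) : ConvexOn ℝ Set.univ (psi m) := by
  refine ⟨convex_univ, fun x _ y _ a b ha hb hab => ?_⟩
  have hconv := (convexOn_rpow (by linarith : 1 ≤ m + 1)).2 (Set.mem_Ici.2 (abs_nonneg x))
    (Set.mem_Ici.2 (abs_nonneg y)) ha hb hab
  have habs : |a • x + b • y| ≤ a • |x| + b • |y| := by
    simpa [abs_mul, abs_of_nonneg ha, abs_of_nonneg hb] using abs_add_le (a * x) (b * y)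
  have hle := (Real.rpow_le_rpow (abs_nonneg _) habs (by linarith : 0 ≤ m + 1)).trans hconv
  simp only [smul_eq_mul, psi] at hle ⊢
  calc _ ≤ (a * |x| ^ (m + 1) + b * |y| ^ (m + 1)) / (m + 1) := by gcongr
    _ = _ := by ring

/-- The optimality condition for a proximal point of a convex function. -/
lemma ConvexOn.subgradient_of_prox {f : ℝ → ℝ} (hf : ConvexOn ℝ Set.univ f) {ε a p : ℝ}
    (hε : 0 < ε) (hp : ∀ s, (a - p) ^ 2 / (2 * ε) + f p ≤ (a - s) ^ 2 / (2 * ε) + f s) (s : ℝ) :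
    (a - p) / ε * (s - p) ≤ f s - f p := by
  by_contra! hlt
  set K := (s - p) ^ 2 / (2 * ε)
  set δ := (a - p) / ε * (s - p) - (f s - f p)
  have hδ : 0 < δ := by simp only [δ]; linarith
  have hK : 0 ≤ K := by positivity
  set t := δ / (δ + K)
  have ht : 0 < t := by positivity
  have ht1 : t ≤ 1 := by
    simp only [t]; rw [div_le_one (by positivity)]; linarith
  have htK : t * K < δ := by
    simp only [t]
    rw [div_mul_eq_mul_div, div_lt_iff₀ (by positivity)]
    nlinarith
  have hc := hf.2 (Set.mem_univ p) (Set.mem_univ s) (by linarith : 0 ≤ 1 - t) ht.le (by ring)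
  have hmin := hp ((1 - t) • p + t • s)
  simp only [smul_eq_mul] at hc hmin
  have hexp : (a - ((1 - t) * p + t * s)) ^ 2 / (2 * ε)
      = (a - p) ^ 2 / (2 * ε) - t * ((a - p) / ε * (s - p)) + t * (t * K) := by
    simp only [K]; field_simp; ring
  have hprod : t * (t * K) < t * δ := mul_lt_mul_of_pos_left htK ht
  have hδt : t * δ = t * ((a - p) / ε * (s - p)) - t * (f s - f p) := by simp only [δ]; ring
  linarith

lemma hasDerivAt_psi {m p : ℝ} (hm : 0 ≤ m) (hp : p ≠ 0) :
    HasDerivAt (psi m) (SignType.sign p * |p| ^ m) p := by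
  have h := ((hasDerivAt_abs hp).rpow_const (p := m + 1)
    (Or.inl (abs_ne_zero.mpr hp))).div_const (m + 1)
  have hm' : m + 1 ≠ 0 := by linarith
  have heq : SignType.sign p * (m + 1) * |p| ^ (m + 1 - 1) / (m + 1) = SignType.sign p * |p| ^ m := by
    rw [add_sub_cancel_right]
    field_simp
  rwa [heq] at h

lemma sq_le_of_subgradient_psi {m : ℝ} (hm : m ∈ Set.Icc (0 : ℝ) 1) {u p : ℝ}
    (hu : ∀ s, u * (s - p) ≤ psi m s - psi m p) : u ^ 2 ≤ 1 + p ^ 2 := by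
  obtain ⟨hm0, hm1⟩ := hm
  rcases eq_or_ne p 0 with rfl | hp
  · have h1 := hu 1
    have h2 := hu (-1)
    have hle : 1 / (m + 1) ≤ 1 := by rw [div_le_one (by linarith)]; linarith
    simp only [psi_zero hm0] at h1 h2
    simp only [psi, abs_neg, abs_one, Real.one_rpow] at h1 h2
    nlinarith
  · have hmin : IsLocalMin (fun s => psi m s - u * s) p :=
      Filter.Eventually.of_forall fun s => by linarith [hu s]
    have hderiv := hmin.hasDerivAt_eq_zero
      ((hasDerivAt_psi hm0 hp).sub ((hasDerivAt_id p).const_mul u))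
    have hueq : |u| = |p| ^ m := by
      have : u = SignType.sign p * |p| ^ m := by linarith
      rw [this, abs_mul, abs_of_nonneg (by positivity : 0 ≤ |p| ^ m)]
      rcases hp.lt_or_gt with h | h <;> simp [h]
    rw [← sq_abs u, ← sq_abs p, hueq]
    have hpos : 0 ≤ |p| ^ m := by positivity
    rcases le_total |p| 1 with h | h
    · nlinarith [Real.rpow_le_one (abs_nonneg p) h hm0, sq_nonneg |p|]
    · have := Real.rpow_le_rpow_of_exponent_le h hm1
      rw [Real.rpow_one] at this
      nlinarith

theorem stmt_12 (m : ℝ) (hm : m ∈ Set.Icc (0 : ℝ) 1)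
    (ε₁ ε₂ : ℝ) (hε₁ : 0 < ε₁) (hε₂ : 0 < ε₂)
    (J₁ J₂ : ℝ → ℝ)
    (hJ₁ : ∀ r s : ℝ,
      (r - J₁ r) ^ 2 / (2 * ε₁) + psi m (J₁ r) ≤ (r - s) ^ 2 / (2 * ε₁) + psi m s)
    (hJ₂ : ∀ r s : ℝ,
      (r - J₂ r) ^ 2 / (2 * ε₂) + psi m (J₂ r) ≤ (r - s) ^ 2 / (2 * ε₂) + psi m s) :
    ∀ a b : ℝ,
      ((a - J₁ a) / ε₁ - (b - J₂ b) / ε₂) * (a - b) ≥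
        -(ε₁ + ε₂) * (1 + a ^ 2 + b ^ 2) := by
  intro a b
  have hm0 := hm.1
  have hu := (convexOn_psi hm0).subgradient_of_prox hε₁ (hJ₁ a)
  have hv := (convexOn_psi hm0).subgradient_of_prox hε₂ (hJ₂ b)
  have hp : a = J₁ a + ε₁ * ((a - J₁ a) / ε₁) := by field_simp; ring
  have hq : b = J₂ b + ε₂ * ((b - J₂ b) / ε₂) := by field_simp; ring
  generalize (a - J₁ a) / ε₁ = u at *
  generalize (b - J₂ b) / ε₂ = v at *
  generalize J₁ a = p at *
  generalize J₂ b = q at *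
  have hup : 0 ≤ u * p := by linarith [hu 0, psi_zero hm0, psi_nonneg hm0 p]
  have hvq : 0 ≤ v * q := by linarith [hv 0, psi_zero hm0, psi_nonneg hm0 q]
  have hpa : p ^ 2 ≤ a ^ 2 := by
    rw [hp]; nlinarith [mul_nonneg hε₁.le hup, sq_nonneg (ε₁ * u)]
  have hqb : q ^ 2 ≤ b ^ 2 := by
    rw [hq]; nlinarith [mul_nonneg hε₂.le hvq, sq_nonneg (ε₂ * v)]
  have hua := sq_le_of_subgradient_psi hm hu
  have hvb := sq_le_of_subgradient_psi hm hv
  have hmono : 0 ≤ (u - v) * (p - q) := by linarith [hu q, hv p]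
  have huv : u * v ≤ 1 + a ^ 2 + b ^ 2 := by
    linarith [sq_nonneg (u - v), sq_nonneg a, sq_nonneg b]
  have hexp : (u - v) * (a - b)
      = (u - v) * (p - q) + ε₁ * u ^ 2 + ε₂ * v ^ 2 - (ε₁ + ε₂) * (u * v) := by
    linear_combination (u - v) * hp - (u - v) * hq
  have := mul_le_mul_of_nonneg_left huv (add_pos hε₁ hε₂).le
  have : 0 ≤ ε₁ * u ^ 2 := by positivity
  have : 0 ≤ ε₂ * v ^ 2 := by positivity
  linarith
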